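/- Consider the online uniform label noise model with noise rate ε ∈ (0,1) and α ∈ (0,1). Let (η_t)_{t≥1} be deterministic positive learning rates, set η_0^{−1} := 0, let τ̂_1 ∈ [0,1] be a deterministic initial threshold, and update τ̂_{t+1} = τ̂_t − η_t·g̃(τ̂_t, S̃_t, (S_{t,y})_{y=1}^K). Then for every δ ∈ (0,1) and integer T ≥ 1, with probability at least 1−δ: | (1/T)·Σ_{t=1}^T 1{S_t > τ̂_t} − α | ≤ ((2−ε)/(1−ε))·√(2·log(4/δ))·T^{−1/2} + [ (1 + (max_{1≤t≤T} η_t)·(1+ε)/(1−ε)) · Σ_{t=1}^T |η_t^{−1} − η_{t−1}^{−1}| ]·T^{−1}. -/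

import Mathlib

open MeasureTheory ProbabilityTheory

/-- The robust pinball subgradient. -/
noncomputable def robustGrad (α ε : ℝ) (K : ℕ) (τ stil : ℝ) (s : Fin K → ℝ) : ℝ :=
  (1 / (1 - ε)) * ((if stil ≤ τ then (1:ℝ) else 0) - (1 - α))
    - (ε / ((K : ℝ) * (1 - ε))) * ∑ y : Fin K, ((if s y ≤ τ then (1:ℝ) else 0) - (1 - α))

lemma exp_le_lin {c l d : ℝ} (hc : 0 < c) (hd : |d| ≤ c) :
    Real.exp (l * d) ≤ Real.cosh (l * c) + d / c * Real.sinh (l * c) := by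
  obtain ⟨h1, h2⟩ := abs_le.mp hd
  have ha : 0 ≤ (1 + d/c)/2 := by
    have : -1 ≤ d/c := by rw [le_div_iff₀ hc]; linarith
    linarith
  have hb : 0 ≤ (1 - d/c)/2 := by
    have : d/c ≤ 1 := by rw [div_le_iff₀ hc]; linarith
    linarith
  have := convexOn_exp.2 (Set.mem_univ (l*c)) (Set.mem_univ (-(l*c))) ha hb (by ring)
  simp only [smul_eq_mul] at this
  have e : (1 + d/c)/2 * (l*c) + (1 - d/c)/2 * (-(l*c)) = l * d := by field_simp; ring
  rw [e] at this
  rw [Real.cosh_eq, Real.sinh_eq]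
  linarith

lemma mgf_bound {Ω : Type*} {m0 : MeasurableSpace Ω} (μ : Measure Ω) [IsProbabilityMeasure μ]
    (F : Filtration ℕ m0) (D : ℕ → Ω → ℝ) (c : ℝ) (hc : 0 < c)
    (hD : ∀ t, 1 ≤ t → Measurable[F t] (D t)) (hb : ∀ t, 1 ≤ t → ∀ ω, |D t ω| ≤ c)
    (h0 : ∀ t, 1 ≤ t → ∀ Z : Ω → ℝ, Measurable[F (t-1)] Z → (∃ C, ∀ ω, |Z ω| ≤ C) →
      ∫ ω, Z ω * D t ω ∂μ = 0) (l : ℝ) (n : ℕ) :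
    Measurable[F n] (fun ω => ∑ t ∈ Finset.Icc 1 n, D t ω) ∧
    (∀ ω, |∑ t ∈ Finset.Icc 1 n, D t ω| ≤ n * c) ∧
    ∫ ω, Real.exp (l * ∑ t ∈ Finset.Icc 1 n, D t ω) ∂μ ≤ Real.exp (n * ((l * c)^2/2)) := by
  induction n with
  | zero => simp
  | succ n ih =>
    obtain ⟨i1, i2, i3⟩ := ih
    simp_rw [Finset.sum_Icc_succ_top (Nat.le_add_left 1 n)]
    have hDn := hD (n+1) (by omega)
    have hbn := hb (n+1) (by omega)
    refine ⟨(i1.mono (F.mono (Nat.le_succ n)) le_rfl).add hDn, fun ω => ?_, ?_⟩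
    · have := abs_add_le (∑ t ∈ Finset.Icc 1 n, D t ω) (D (n+1) ω)
      have := i2 ω
      have := hbn ω
      push_cast; linarith
    · set M : Ω → ℝ := fun ω => ∑ t ∈ Finset.Icc 1 n, D t ω with hM
      change ∫ ω, Real.exp (l * M ω) ∂μ ≤ _ at i3
      change ∫ ω, Real.exp (l * (M ω + D (n+1) ω)) ∂μ ≤ _
      have hZm : Measurable[F n] (fun ω => Real.exp (l * M ω)) :=
        Real.measurable_exp.comp (i1.const_mul l)
      have hZm' : Measurable (fun ω => Real.exp (l * M ω)) := hZm.mono (F.le n) le_rfl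
      have hDm' : Measurable (D (n+1)) := hDn.mono (F.le _) le_rfl
      have hZb : ∀ ω, |Real.exp (l * M ω)| ≤ Real.exp (|l| * (n * c)) := fun ω => by
        rw [abs_of_pos (Real.exp_pos _)]
        apply Real.exp_le_exp.mpr
        calc l * M ω ≤ |l * M ω| := le_abs_self _
          _ = |l| * |M ω| := abs_mul _ _
          _ ≤ _ := by gcongr; exact i2 ω
      have hz := h0 (n+1) (by omega) _ hZm ⟨_, hZb⟩
      have iZ : Integrable (fun ω => Real.exp (l * M ω)) μ :=
        Integrable.of_bound hZm'.aestronglyMeasurable _ (Filter.Eventually.of_forall hZb)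
      have iZD : Integrable (fun ω => Real.exp (l * M ω) * D (n+1) ω) μ :=
        iZ.mul_bdd hDm'.aestronglyMeasurable (Filter.Eventually.of_forall hbn)
      calc ∫ ω, Real.exp (l * (M ω + D (n+1) ω)) ∂μ
          ≤ ∫ ω, (Real.cosh (l*c) * Real.exp (l * M ω)
              + Real.sinh (l*c) / c * (Real.exp (l * M ω) * D (n+1) ω)) ∂μ := by
            apply integral_mono_of_nonneg
            · exact Filter.Eventually.of_forall fun ω => (Real.exp_pos _).le
            · exact (iZ.const_mul _).add (iZD.const_mul _)
            · refine Filter.Eventually.of_forall fun ω => ?_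
              simp only
              rw [mul_add, Real.exp_add]
              have := mul_le_mul_of_nonneg_left (exp_le_lin (l := l) hc (hbn ω))
                (Real.exp_pos (l * M ω)).le
              refine this.trans (le_of_eq (by ring))
        _ = Real.cosh (l*c) * ∫ ω, Real.exp (l * M ω) ∂μ := by
            rw [integral_add (iZ.const_mul _) (iZD.const_mul _), integral_const_mul,
              integral_const_mul, hz]; ring
        _ ≤ Real.exp ((l*c)^2/2) * Real.exp (n * ((l * c)^2/2)) := by
            gcongr
            exact Real.cosh_le_exp_half_sq _
        _ = _ := by rw [← Real.exp_add]; congr 1; push_cast; ring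

lemma azuma_tail {Ω : Type*} {m0 : MeasurableSpace Ω} (μ : Measure Ω) [IsProbabilityMeasure μ]
    (F : Filtration ℕ m0) (D : ℕ → Ω → ℝ) (c : ℝ) (hc : 0 < c)
    (hD : ∀ t, 1 ≤ t → Measurable[F t] (D t)) (hb : ∀ t, 1 ≤ t → ∀ ω, |D t ω| ≤ c)
    (h0 : ∀ t, 1 ≤ t → ∀ Z : Ω → ℝ, Measurable[F (t-1)] Z → (∃ C, ∀ ω, |Z ω| ≤ C) →
      ∫ ω, Z ω * D t ω ∂μ = 0) (T : ℕ) (hT : 1 ≤ T) (x : ℝ) (hx : 0 ≤ x) :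
    μ.real {ω | x ≤ ∑ t ∈ Finset.Icc 1 T, D t ω} ≤ Real.exp (-(x^2 / (2 * c^2 * T))) := by
  have hT0 : (0:ℝ) < T := by exact_mod_cast hT
  obtain ⟨h1, h2, h3⟩ := mgf_bound μ F D c hc hD hb h0 (x / (c^2 * T)) T
  have hl : 0 ≤ x / (c^2 * T) := by positivity
  have hm := h1.mono (F.le T) le_rfl
  have := measure_ge_le_exp_mul_mgf (μ := μ) (X := fun ω => ∑ t ∈ Finset.Icc 1 T, D t ω)
    (t := x / (c^2 * T)) x hl (by
      refine Integrable.of_bound (C := Real.exp (x / (c^2 * T) * (T * c)))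
        (Real.measurable_exp.comp (hm.const_mul _)).aestronglyMeasurable
        (Filter.Eventually.of_forall fun ω => ?_)
      rw [Real.norm_eq_abs, abs_of_pos (Real.exp_pos _)]
      apply Real.exp_le_exp.mpr
      gcongr
      exact (le_abs_self _).trans (h2 ω))
  refine this.trans ((mul_le_mul_of_nonneg_left h3 (Real.exp_pos _).le).trans (le_of_eq ?_))
  rw [← Real.exp_add]
  congr 1
  field_simp
  ring

lemma indep3_integral {Ω : Type*} (m1 m2 m3 : MeasurableSpace Ω) {m0 : MeasurableSpace Ω}
    (μ : Measure Ω) [IsProbabilityMeasure μ]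
    (h1 : m1 ≤ m0) (h2 : m2 ≤ m0) (h3 : m3 ≤ m0) (hI : iIndep ![m1, m2, m3] μ)
    (A B : Set Ω) (hA : MeasurableSet[m1] A) (hB : MeasurableSet[m2] B)
    (W : Ω → ℝ) (hW : Measurable[m3] W) :
    ∫ ω, (A ∩ B).indicator (1 : Ω → ℝ) ω * W ω ∂μ = μ.real A * μ.real B * ∫ ω, W ω ∂μ := by
  have hle : ∀ i, ![m1, m2, m3] i ≤ m0 := by
    intro i; fin_cases i <;> assumption
  have hd := indep_iSup_of_disjoint hle hI (S := {0, 1}) (T := {2}) (by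
    simp [Set.disjoint_left])
  have hAB : MeasurableSet[⨆ i ∈ ({0, 1} : Set (Fin 3)), ![m1, m2, m3] i] (A ∩ B) := by
    apply MeasurableSet.inter
    · have : m1 ≤ ⨆ i ∈ ({0, 1} : Set (Fin 3)), ![m1, m2, m3] i :=
        le_iSup₂_of_le (0 : Fin 3) (by simp) le_rfl
      exact this _ hA
    · have : m2 ≤ ⨆ i ∈ ({0, 1} : Set (Fin 3)), ![m1, m2, m3] i :=
        le_iSup₂_of_le (1 : Fin 3) (by simp) le_rfl
      exact this _ hB
  have hm3 : m3 ≤ ⨆ i ∈ ({2} : Set (Fin 3)), ![m1, m2, m3] i :=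
    le_iSup₂_of_le (2 : Fin 3) (by simp) le_rfl
  have hAB0 : MeasurableSet (A ∩ B) := (h1 _ hA).inter (h2 _ hB)
  have hind : Measurable[⨆ i ∈ ({0, 1} : Set (Fin 3)), ![m1, m2, m3] i]
      ((A ∩ B).indicator (1 : Ω → ℝ)) := by
    refine Measurable.indicator ?_ hAB
    exact @measurable_const _ _ _ _ (1:ℝ)
  have hfun : IndepFun ((A ∩ B).indicator (1 : Ω → ℝ)) W μ := by
    rw [IndepFun_iff_Indep]
    exact indep_of_indep_of_le_left (indep_of_indep_of_le_right hd (hW.comap_le.trans hm3))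
      hind.comap_le
  rw [hfun.integral_fun_mul_eq_mul_integral
    ((measurable_one.indicator hAB0).aestronglyMeasurable)
    ((hW.mono h3 le_rfl).aestronglyMeasurable), integral_indicator_one hAB0]
  have h12 : Indep m1 m2 μ := hI.indep (i := 0) (j := 1) (by decide)
  have : μ (A ∩ B) = μ A * μ B := (Indep_iff _ _ _).1 h12 A B hA hB
  simp [Measure.real, this, ENNReal.toReal_mul]

lemma measurable_select {Ω : Type*} {m : MeasurableSpace Ω} {K : ℕ} (N : Ω → Fin K)
    (X : Fin K → Ω → ℝ) (hN : Measurable N) (hX : ∀ y, Measurable (X y)) :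
    Measurable (fun ω => X (N ω) ω) := by
  have : Measurable (fun p : Fin K × Ω => X p.1 p.2) := measurable_from_prod_countable_right hX
  exact this.comp (hN.prodMk measurable_id)

lemma measurable_le_ite {Ω : Type*} {m : MeasurableSpace Ω} {s τ : Ω → ℝ}
    (hs : Measurable s) (hτ : Measurable τ) :
    Measurable (fun ω => if s ω ≤ τ ω then (1:ℝ) else 0) :=
  Measurable.ite (measurableSet_le hs hτ) measurable_const measurable_const

lemma measurable_robustGrad {Ω : Type*} {m : MeasurableSpace Ω} {K : ℕ} (α ε : ℝ)
    (τ s : Ω → ℝ) (X : Fin K → Ω → ℝ) (hτ : Measurable τ) (hs : Measurable s)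
    (hX : ∀ y, Measurable (X y)) :
    Measurable (fun ω => robustGrad α ε K (τ ω) (s ω) (fun y => X y ω)) := by
  unfold robustGrad
  refine Measurable.sub (Measurable.const_mul (Measurable.sub_const ?_ _) _)
    (Measurable.const_mul (Finset.measurable_sum _ fun y _ => Measurable.sub_const ?_ _) _)
  · exact Measurable.ite (measurableSet_le hs hτ) measurable_const measurable_const
  · exact Measurable.ite (measurableSet_le (hX y) hτ) measurable_const measurable_const

lemma robustGrad_eq (α ε : ℝ) (K : ℕ) (hK : 1 ≤ K) (hε : ε < 1) (τ s : ℝ) (X : Fin K → ℝ) :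
    robustGrad α ε K τ s X = (1 / (1 - ε)) * (if s ≤ τ then (1:ℝ) else 0)
      - (ε / (1 - ε)) * ((∑ y, if X y ≤ τ then (1:ℝ) else 0) / K) - (1 - α) := by
  have h1 : (1 - ε) ≠ 0 := by linarith
  have h2 : (K : ℝ) ≠ 0 := by positivity
  unfold robustGrad
  rw [Finset.sum_sub_distrib]
  simp only [Finset.sum_const, Finset.card_univ, Fintype.card_fin, nsmul_eq_mul]
  field_simp
  ring

lemma avg_mem (K : ℕ) (hK : 1 ≤ K) (τ : ℝ) (X : Fin K → ℝ) :
    0 ≤ (∑ y, if X y ≤ τ then (1:ℝ) else 0) / K ∧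
    (∑ y, if X y ≤ τ then (1:ℝ) else 0) / K ≤ 1 := by
  have h2 : (0:ℝ) < (K : ℝ) := by positivity
  constructor
  · apply div_nonneg _ h2.le
    exact Finset.sum_nonneg fun y _ => by split_ifs <;> norm_num
  · rw [div_le_one h2]
    calc _ ≤ ∑ y : Fin K, (1:ℝ) := Finset.sum_le_sum fun y _ => by split_ifs <;> norm_num
      _ = K := by simp

lemma integral_lin4 {Ω : Type*} {m0 : MeasurableSpace Ω} (μ : Measure Ω)
    (f g h k : Ω → ℝ) (a b : ℝ) (hf : Integrable f μ) (hg : Integrable g μ)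
    (hh : Integrable h μ) (hk : Integrable k μ) :
    ∫ ω, ((f ω - a * (g ω + h ω)) + b * k ω) ∂μ
      = (∫ ω, f ω ∂μ - a * (∫ ω, g ω ∂μ + ∫ ω, h ω ∂μ)) + b * ∫ ω, k ω ∂μ := by
  have h1 : Integrable (fun ω => g ω + h ω) μ := hg.add hh
  have h2 : Integrable (fun ω => a * (g ω + h ω)) μ := h1.const_mul a
  have h3 : Integrable (fun ω => f ω - a * (g ω + h ω)) μ := hf.sub h2
  rw [integral_add h3 (hk.const_mul b), integral_sub hf h2, integral_const_mul,
    integral_const_mul, integral_add hg hh]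

lemma zero_mean {Ω : Type*} (G m3 : MeasurableSpace Ω) {m0 : MeasurableSpace Ω}
    (μ : Measure Ω) [IsProbabilityMeasure μ] (hG3 : G ≤ m3) (hle3 : m3 ≤ m0)
    (K : ℕ) (hK : 1 ≤ K) (ε α : ℝ) (hε : ε ∈ Set.Ioo (0:ℝ) 1)
    (S : Fin K → Ω → ℝ) (Y : Ω → Fin K) (U : Ω → ℝ) (Ybar : Ω → Fin K)
    (hS : ∀ y, Measurable (S y)) (hY : Measurable Y) (hU : Measurable U) (hYb : Measurable Ybar)
    (hU_unif : Measure.map U μ = volume.restrict (Set.Icc (0:ℝ) 1))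
    (hYb_unif : ∀ y : Fin K, μ {ω | Ybar ω = y} = (K : ENNReal)⁻¹)
    (hI : iIndep ![MeasurableSpace.comap U inferInstance,
          MeasurableSpace.comap Ybar inferInstance,
          m3] μ)
    (hpair : Measurable[m3] (fun ω => (Y ω, fun y => S y ω)))
    (Yt : Ω → Fin K) (hYt : ∀ ω, Yt ω = if ε ≤ U ω then Y ω else Ybar ω)
    (τ : Ω → ℝ) (hτ : Measurable[G] τ) (Z : Ω → ℝ) (hZ : Measurable[G] Z)
    (hZb : ∃ C, ∀ ω, |Z ω| ≤ C) :
    ∫ ω, Z ω * (((if S (Y ω) ω ≤ τ ω then (1:ℝ) else 0) - (1 - α))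
      - robustGrad α ε K (τ ω) (S (Yt ω) ω) (fun y => S y ω)) ∂μ = 0 := by
  obtain ⟨C, hC⟩ := hZb
  have he1 : (1 - ε) ≠ 0 := by linarith [hε.2]
  have hK0 : (K : ℝ) ≠ 0 := by positivity
  have hY3 : Measurable[m3] Y := measurable_fst.comp hpair
  have hS3 : ∀ y, Measurable[m3] (S y) := fun y =>
    (measurable_pi_apply y).comp (measurable_snd.comp hpair)
  have hτ3 : Measurable[m3] τ := hτ.mono hG3 le_rfl
  have hZ3 : Measurable[m3] Z := hZ.mono hG3 le_rfl
  set I : Fin K → Ω → ℝ := fun y ω => if S y ω ≤ τ ω then (1:ℝ) else 0 with hIdef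
  have hI3 : ∀ y, Measurable[m3] (I y) := fun y =>
    measurable_le_ite (hS3 y) hτ3
  have hIb : ∀ y ω, |I y ω| ≤ 1 := fun y ω => by
    simp only [hIdef]; split_ifs <;> simp
  have ha3 : Measurable[m3] (fun ω => I (Y ω) ω) := @measurable_select _ m3 _ Y I hY3 hI3
  have key := indep3_integral _ _ m3 μ hU.comap_le hYb.comap_le hle3 hI
  have hA : MeasurableSet[MeasurableSpace.comap U inferInstance] {ω | ε ≤ U ω} :=
    ⟨Set.Ici ε, measurableSet_Ici, rfl⟩
  have hA' : MeasurableSet[MeasurableSpace.comap U inferInstance] {ω | U ω < ε} :=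
    ⟨Set.Iio ε, measurableSet_Iio, rfl⟩
  have hB : ∀ y, MeasurableSet[MeasurableSpace.comap Ybar inferInstance] {ω | Ybar ω = y} :=
    fun y => ⟨{y}, measurableSet_singleton y, rfl⟩
  have pA : μ.real {ω | ε ≤ U ω} = 1 - ε := by
    have : μ {ω | ε ≤ U ω} = Measure.map U μ (Set.Ici ε) := by
      rw [Measure.map_apply hU measurableSet_Ici]; rfl
    rw [Measure.real, this, hU_unif, Measure.restrict_apply measurableSet_Ici]
    have : Set.Ici ε ∩ Set.Icc 0 1 = Set.Icc ε 1 := by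
      ext x; simp only [Set.mem_inter_iff, Set.mem_Ici, Set.mem_Icc]
      constructor
      · rintro ⟨a, b, c⟩; exact ⟨a, c⟩
      · rintro ⟨a, b⟩; exact ⟨a, by linarith [hε.1], b⟩
    rw [this, Real.volume_Icc, ENNReal.toReal_ofReal (by linarith [hε.2])]
  have pA' : μ.real {ω | U ω < ε} = ε := by
    have : {ω | U ω < ε} = {ω | ε ≤ U ω}ᶜ := by ext; simp
    have hm : MeasurableSet {ω | ε ≤ U ω} := hU measurableSet_Ici
    rw [this, probReal_compl_eq_one_sub hm, pA]; ring
  have pB : ∀ y, μ.real {ω | Ybar ω = y} = (K : ℝ)⁻¹ := fun y => by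
    rw [Measure.real, hYb_unif]; simp
  have k1 := key _ Set.univ hA (@MeasurableSet.univ _ _) _ (hZ3.mul ha3)
  have k2 := fun y => key _ _ hA' (hB y) _ (hZ3.mul (hI3 y))
  simp only [pA, pA', pB, Set.inter_univ, probReal_univ, mul_one, Pi.mul_apply] at k1 k2
  have hC0 : ∀ ω, 0 ≤ C := fun ω => (abs_nonneg _).trans (hC ω)
  have ia : Integrable (fun ω => Z ω * I (Y ω) ω) μ :=
    Integrable.of_bound (C := C) ((hZ3.mul ha3).mono hle3 le_rfl).aestronglyMeasurable
      (Filter.Eventually.of_forall fun ω => by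
        rw [norm_mul]
        exact (mul_le_mul (hC ω) (hIb _ ω) (abs_nonneg _) (hC0 ω)).trans (by simp))
  have iI : ∀ y, Integrable (fun ω => Z ω * I y ω) μ := fun y =>
    Integrable.of_bound (C := C) ((hZ3.mul (hI3 y)).mono hle3 le_rfl).aestronglyMeasurable
      (Filter.Eventually.of_forall fun ω => by
        rw [norm_mul]
        exact (mul_le_mul (hC ω) (hIb _ ω) (abs_nonneg _) (hC0 ω)).trans (by simp))
  have hindb : ∀ (E : Set Ω) ω, ‖E.indicator (1 : Ω → ℝ) ω‖ ≤ 1 := fun E ω => by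
    by_cases h : ω ∈ E <;> simp [h]
  have hE1 : MeasurableSet {ω | ε ≤ U ω} := hU measurableSet_Ici
  have hE2 : ∀ y, MeasurableSet ({ω | U ω < ε} ∩ {ω | Ybar ω = y}) := fun y =>
    (hU measurableSet_Iio).inter (hYb (measurableSet_singleton y))
  have ia' : Integrable (fun ω => {ω | ε ≤ U ω}.indicator (1 : Ω → ℝ) ω * (Z ω * I (Y ω) ω)) μ :=
    ia.bdd_mul (measurable_one.indicator hE1).aestronglyMeasurable
      (Filter.Eventually.of_forall (hindb _))
  have iI' : ∀ y, Integrable (fun ω => ({ω | U ω < ε} ∩ {ω | Ybar ω = y}).indicator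
      (1 : Ω → ℝ) ω * (Z ω * I y ω)) μ := fun y =>
    (iI y).bdd_mul (measurable_one.indicator (hE2 y)).aestronglyMeasurable
      (Filter.Eventually.of_forall (hindb _))
  have hpt : ∀ ω, Z ω * (((if S (Y ω) ω ≤ τ ω then (1:ℝ) else 0) - (1 - α))
      - robustGrad α ε K (τ ω) (S (Yt ω) ω) (fun y => S y ω))
      = (Z ω * I (Y ω) ω - (1 / (1 - ε)) *
        ({ω | ε ≤ U ω}.indicator (1 : Ω → ℝ) ω * (Z ω * I (Y ω) ω)
        + ∑ y, ({ω | U ω < ε} ∩ {ω | Ybar ω = y}).indicator (1 : Ω → ℝ) ω * (Z ω * I y ω)))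
        + ε / (1 - ε) / K * ∑ y, Z ω * I y ω := by
    intro ω
    rw [robustGrad_eq α ε K hK hε.2]
    change Z ω * ((I (Y ω) ω - (1 - α)) - ((1 / (1 - ε)) * I (Yt ω) ω
      - (ε / (1 - ε)) * ((∑ y, I y ω) / K) - (1 - α))) = _
    have hsel : {ω | ε ≤ U ω}.indicator (1 : Ω → ℝ) ω * (Z ω * I (Y ω) ω)
        + ∑ y, ({ω | U ω < ε} ∩ {ω | Ybar ω = y}).indicator (1 : Ω → ℝ) ω * (Z ω * I y ω)
        = Z ω * I (Yt ω) ω := by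
      rw [hYt]
      by_cases h : ε ≤ U ω
      · simp [h, Set.indicator, not_lt.mpr h]
      · have h' : U ω < ε := not_le.mp h
        simp [h, h', Set.indicator]
    rw [hsel, ← Finset.mul_sum]
    ring
  rw [integral_congr_ae (Filter.Eventually.of_forall hpt)]
  have is1 : Integrable (fun ω => ∑ y, ({ω | U ω < ε} ∩ {ω | Ybar ω = y}).indicator
      (1 : Ω → ℝ) ω * (Z ω * I y ω)) μ := integrable_finsetSum _ fun y _ => iI' y
  have is2 : Integrable (fun ω => ∑ y, Z ω * I y ω) μ := integrable_finsetSum _ fun y _ => iI y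
  rw [integral_lin4 μ _ _ _ _ _ _ ia ia' is1 is2, integral_finsetSum _ fun y _ => iI' y,
    integral_finsetSum _ fun y _ => iI y, k1]
  simp_rw [k2]
  rw [← Finset.mul_sum]
  field_simp
  ring

lemma tau_bound (α ε : ℝ) (K : ℕ) (hK : 1 ≤ K) (hε : ε ∈ Set.Ioo (0:ℝ) 1)
    (hα : α ∈ Set.Ioo (0:ℝ) 1) (η H τ s : ℝ) (X : Fin K → ℝ) (hX : ∀ y, X y ∈ Set.Icc (0:ℝ) 1)
    (hs : s ∈ Set.Icc (0:ℝ) 1) (hη : 0 < η) (hH : η ≤ H)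
    (h1 : -(H * ((α + ε * (1 - α)) / (1 - ε))) ≤ τ)
    (h2 : τ ≤ 1 + H * ((1 - α + ε * α) / (1 - ε))) :
    -(H * ((α + ε * (1 - α)) / (1 - ε))) ≤ τ - η * robustGrad α ε K τ s X ∧
    τ - η * robustGrad α ε K τ s X ≤ 1 + H * ((1 - α + ε * α) / (1 - ε)) := by
  obtain ⟨e0, e1⟩ := hε
  obtain ⟨a0, a1⟩ := hα
  have he : 0 < 1 - ε := by linarith
  have hK0 : (K : ℝ) ≠ 0 := by positivity
  have hA : 0 ≤ (α + ε * (1 - α)) / (1 - ε) := by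
    apply div_nonneg _ he.le; nlinarith
  have hB : 0 ≤ (1 - α + ε * α) / (1 - ε) := by
    apply div_nonneg _ he.le; nlinarith
  have hA1 : η * ((α + ε * (1 - α)) / (1 - ε)) ≤ H * ((α + ε * (1 - α)) / (1 - ε)) :=
    mul_le_mul_of_nonneg_right hH hA
  have hB1 : η * ((1 - α + ε * α) / (1 - ε)) ≤ H * ((1 - α + ε * α) / (1 - ε)) :=
    mul_le_mul_of_nonneg_right hH hB
  have hA2 : α ≤ (α + ε * (1 - α)) / (1 - ε) := by
    rw [le_div_iff₀ he]; nlinarith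
  have hB2 : 1 - α ≤ (1 - α + ε * α) / (1 - ε) := by
    rw [le_div_iff₀ he]; nlinarith
  rw [robustGrad_eq α ε K hK e1]
  rcases lt_or_ge τ 0 with h | h
  · have n1 : ¬ s ≤ τ := by linarith [hs.1]
    have n2 : ∀ y, ¬ X y ≤ τ := fun y => by linarith [(hX y).1]
    simp only [n1, n2, if_false, Finset.sum_const_zero]
    have := mul_le_mul_of_nonneg_left hB2 hη.le
    have : 0 ≤ η * (1 - α) := by nlinarith
    constructor <;> simp <;> nlinarith
  rcases le_or_gt 1 τ with h' | h'
  · have n1 : s ≤ τ := by linarith [hs.2]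
    have n2 : ∀ y, X y ≤ τ := fun y => by linarith [(hX y).2]
    have e : (1 / (1 - ε)) * (1:ℝ) - (ε / (1 - ε)) * 1 - (1 - α) = α := by
      field_simp; ring
    simp only [n1, n2, if_true, Finset.sum_const, Finset.card_univ, Fintype.card_fin,
      nsmul_eq_mul, mul_one, div_self hK0] at e ⊢
    rw [e]
    have := mul_le_mul_of_nonneg_left hA2 hη.le
    have : 0 ≤ η * α := by positivity
    constructor <;> linarith
  · obtain ⟨c0, c1⟩ := avg_mem K hK τ X
    set c := (∑ y, if X y ≤ τ then (1:ℝ) else 0) / K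
    have hb : 0 ≤ (if s ≤ τ then (1:ℝ) else 0) ∧ (if s ≤ τ then (1:ℝ) else 0) ≤ 1 := by
      split_ifs <;> norm_num
    set b := (if s ≤ τ then (1:ℝ) else 0)
    have eq : (1 / (1 - ε)) * b - (ε / (1 - ε)) * c - (1 - α)
        = (b - ε * c - (1 - α) * (1 - ε)) / (1 - ε) := by field_simp
    have u : (1 / (1 - ε)) * b - (ε / (1 - ε)) * c - (1 - α) ≤ (α + ε * (1 - α)) / (1 - ε) := by
      rw [eq]; apply div_le_div_of_nonneg_right _ he.le; nlinarith [mul_nonneg e0.le c0]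
    have l : -((1 - α + ε * α) / (1 - ε)) ≤ (1 / (1 - ε)) * b - (ε / (1 - ε)) * c - (1 - α) := by
      rw [eq, ← neg_div]; apply div_le_div_of_nonneg_right _ he.le
      nlinarith [mul_le_mul_of_nonneg_left c1 e0.le]
    have := mul_le_mul_of_nonneg_left u hη.le
    have := mul_le_mul_of_nonneg_left l hη.le
    constructor <;> linarith

lemma abel_sum (η x g : ℕ → ℝ) (hη : ∀ t, 1 ≤ t → 0 < η t) (hη0 : η 0 = 0)
    (hx : ∀ t, 1 ≤ t → x (t+1) = x t - η t * g t) (R : ℝ) (n : ℕ) :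
    ∑ t ∈ Finset.Icc 1 n, g t =
      ∑ t ∈ Finset.Icc 1 n, ((η t)⁻¹ - (η (t-1))⁻¹) * (x t - R) - (η n)⁻¹ * (x (n+1) - R) := by
  induction n with
  | zero => simp [hη0]
  | succ n ih =>
    rw [Finset.sum_Icc_succ_top (by omega), Finset.sum_Icc_succ_top (by omega), ih,
      hx (n+1) (by omega)]
    have := (hη (n+1) (by omega)).ne'
    simp only [Nat.add_sub_cancel]
    field_simp
    ring

lemma le_max_eta (η : ℕ → ℝ) (hη : ∀ t, 1 ≤ t → 0 < η t) (T t : ℕ) (ht : t ∈ Finset.Icc 1 T) :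
    η t ≤ ⨆ t ∈ Finset.Icc 1 T, η t := by
  have hnn : ∀ s ∈ Finset.Icc 1 T, 0 ≤ η s := fun s hs => (hη s (Finset.mem_Icc.1 hs).1).le
  have hb : BddAbove (Set.range fun t => ⨆ (_ : t ∈ Finset.Icc 1 T), η t) := by
    refine ⟨∑ s ∈ Finset.Icc 1 T, η s, ?_⟩
    rintro _ ⟨s, rfl⟩
    by_cases hs : s ∈ Finset.Icc 1 T
    · simp only [ciSup_pos hs]
      exact Finset.single_le_sum hnn hs
    · have : IsEmpty (s ∈ Finset.Icc 1 T) := ⟨hs⟩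
      simp only [Real.iSup_of_isEmpty]
      exact Finset.sum_nonneg hnn
  have := le_ciSup hb t
  simp only [ciSup_pos ht] at this
  exact this

/-- empirical coverage error bound for NR-OCP (online conformal prediction with
robust pinball subgradient updates) under uniform label noise, dynamic learning rates. -/
theorem nrocp_empirical_coverage_error_dynamic_lr
    {Ω : Type*} {m0 : MeasurableSpace Ω} (μ : Measure Ω) [IsProbabilityMeasure μ]
    (F : Filtration ℕ m0)
    (K : ℕ) (hK : 1 ≤ K) (ε α : ℝ) (hε : ε ∈ Set.Ioo (0:ℝ) 1) (hα : α ∈ Set.Ioo (0:ℝ) 1)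
    (S : ℕ → Fin K → Ω → ℝ) (Y : ℕ → Ω → Fin K) (U : ℕ → Ω → ℝ) (Ybar : ℕ → Ω → Fin K)
    -- measurability of the scores and labels with respect to the filtration
    (hS_meas : ∀ t, 1 ≤ t → ∀ y, Measurable[F t] (S t y))
    (hS_range : ∀ t, 1 ≤ t → ∀ y ω, S t y ω ∈ Set.Icc (0:ℝ) 1)
    (hY_meas : ∀ t, 1 ≤ t → Measurable[F t] (Y t))
    (hU_meas : ∀ t, 1 ≤ t → Measurable[F t] (U t))
    (hYbar_meas : ∀ t, 1 ≤ t → Measurable[F t] (Ybar t))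
    -- U_t is uniformly distributed on [0,1], Ȳ_t uniformly on {1,…,K}
    (hU_unif : ∀ t, 1 ≤ t → Measure.map (U t) μ = volume.restrict (Set.Icc (0:ℝ) 1))
    (hYbar_unif : ∀ t, 1 ≤ t → ∀ y : Fin K, μ {ω | Ybar t ω = y} = (K : ENNReal)⁻¹)
    -- U_t, Ȳ_t and the σ-algebra generated by F_{t-1} together with (Y_t, S_{t,·})
    -- are mutually independent
    (hIndep : ∀ t, 1 ≤ t →
      iIndep
        ![MeasurableSpace.comap (U t) inferInstance,
          MeasurableSpace.comap (Ybar t) inferInstance,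
          (F (t - 1) : MeasurableSpace Ω) ⊔
            MeasurableSpace.comap (fun ω => (Y t ω, fun y => S t y ω)) inferInstance] μ)
    -- the noisy labels
    (Ytil : ℕ → Ω → Fin K)
    (hYtil : ∀ t, 1 ≤ t → ∀ ω, Ytil t ω = if ε ≤ U t ω then Y t ω else Ybar t ω)
    -- dynamic positive learning rates, with the convention η₀⁻¹ = 0 encoded by η 0 = 0
    (η : ℕ → ℝ) (hη : ∀ t, 1 ≤ t → 0 < η t) (hη0 : η 0 = 0)
    (τ0 : ℝ) (hτ0 : τ0 ∈ Set.Icc (0:ℝ) 1)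
    (τ : ℕ → Ω → ℝ) (hτ1 : ∀ ω, τ 1 ω = τ0)
    -- NR-OCP update using the robust pinball subgradient
    (hupd : ∀ t, 1 ≤ t → ∀ ω,
      τ (t + 1) ω = τ t ω
        - η t * robustGrad α ε K (τ t ω) (S t (Ytil t ω) ω) (fun y => S t y ω))
    (δ : ℝ) (hδ : δ ∈ Set.Ioo (0:ℝ) 1) (T : ℕ) (hT : 1 ≤ T) :
    ENNReal.ofReal (1 - δ) ≤
      μ {ω |
        |(1 / (T : ℝ)) * (∑ t ∈ Finset.Icc 1 T,
              (if τ t ω < S t (Y t ω) ω then (1:ℝ) else 0))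
            - α|
          ≤ ((2 - ε) / (1 - ε)) * Real.sqrt (2 * Real.log (4 / δ)) / Real.sqrt T
            + ((1 + (⨆ t ∈ Finset.Icc 1 T, η t) * ((1 + ε) / (1 - ε)))
                * ∑ t ∈ Finset.Icc 1 T, |(η t)⁻¹ - (η (t - 1))⁻¹|) / T} := by
  classical
  obtain ⟨e0, e1⟩ := id hε
  obtain ⟨d0, d1⟩ := id hδ
  have he : 0 < 1 - ε := by linarith
  have hT0 : (0:ℝ) < T := by exact_mod_cast hT
  set H := ⨆ t ∈ Finset.Icc 1 T, η t with hH
  set c : ℝ := (2 - ε) / (1 - ε) with hcdef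
  have hc : 0 < c := div_pos (by linarith) he
  set rg : ℕ → Ω → ℝ := fun t ω =>
    robustGrad α ε K (τ t ω) (S t (Ytil t ω) ω) (fun y => S t y ω) with hrg
  set D : ℕ → Ω → ℝ := fun t ω =>
    ((if S t (Y t ω) ω ≤ τ t ω then (1:ℝ) else 0) - (1 - α)) - rg t ω with hDdef
  -- measurability
  have hYtm : ∀ t, 1 ≤ t → Measurable[F t] (Ytil t) := by
    intro t ht
    have : Ytil t = fun ω => if ε ≤ U t ω then Y t ω else Ybar t ω := funext (hYtil t ht)
    rw [this]
    have hm : MeasurableSet[F t] {ω | ε ≤ U t ω} := hU_meas t ht measurableSet_Ici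
    exact Measurable.ite hm (hY_meas t ht) (hYbar_meas t ht)
  have hrgm : ∀ t, 1 ≤ t → Measurable[F t] (τ t) → Measurable[F t] (rg t) := by
    intro t ht hτt
    exact @measurable_robustGrad _ (F t) K α ε (τ t) _ (S t) hτt
      (@measurable_select _ (F t) K (Ytil t) (S t) (hYtm t ht) (hS_meas t ht)) (hS_meas t ht)
  have hτm : ∀ n, Measurable[F n] (τ (n+1)) := by
    intro n
    induction n with
    | zero =>
      have : τ (0+1) = fun _ => τ0 := funext hτ1
      rw [this]; exact measurable_const
    | succ n ih =>
      have h1 : Measurable[F (n+1)] (τ (n+1)) := ih.mono (F.mono (Nat.le_succ n)) le_rfl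
      have : τ (n+1+1) = fun ω => τ (n+1) ω - η (n+1) * rg (n+1) ω :=
        funext (hupd (n+1) (by omega))
      rw [this]
      exact h1.sub ((hrgm (n+1) (by omega) h1).const_mul _)
  have hτm' : ∀ t, 1 ≤ t → Measurable[F (t-1)] (τ t) := by
    intro t ht
    have := hτm (t-1)
    rwa [Nat.sub_add_cancel ht] at this
  have hτm'' : ∀ t, 1 ≤ t → Measurable[F t] (τ t) := fun t ht =>
    (hτm' t ht).mono (F.mono (Nat.sub_le t 1)) le_rfl
  have hDm : ∀ t, 1 ≤ t → Measurable[F t] (D t) := fun t ht =>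
    ((@measurable_le_ite _ (F t) _ _ (@measurable_select _ (F t) K (Y t) (S t) (hY_meas t ht)
      (hS_meas t ht)) (hτm'' t ht)).sub_const _).sub (hrgm t ht (hτm'' t ht))
  have hDb : ∀ t, 1 ≤ t → ∀ ω, |D t ω| ≤ c := by
    intro t ht ω
    simp only [hDdef, hrg]
    rw [robustGrad_eq α ε K hK e1]
    obtain ⟨c0, c1⟩ := avg_mem K hK (τ t ω) (fun y => S t y ω)
    set q := (∑ y, if S t y ω ≤ τ t ω then (1:ℝ) else 0) / K
    have ha : 0 ≤ (if S t (Y t ω) ω ≤ τ t ω then (1:ℝ) else 0) ∧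
        (if S t (Y t ω) ω ≤ τ t ω then (1:ℝ) else 0) ≤ 1 := by split_ifs <;> norm_num
    have hb : 0 ≤ (if S t (Ytil t ω) ω ≤ τ t ω then (1:ℝ) else 0) ∧
        (if S t (Ytil t ω) ω ≤ τ t ω then (1:ℝ) else 0) ≤ 1 := by split_ifs <;> norm_num
    set a := (if S t (Y t ω) ω ≤ τ t ω then (1:ℝ) else 0)
    set b := (if S t (Ytil t ω) ω ≤ τ t ω then (1:ℝ) else 0)
    have eq : a - (1 - α) - ((1 / (1 - ε)) * b - (ε / (1 - ε)) * q - (1 - α))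
        = (a * (1 - ε) - b + ε * q) / (1 - ε) := by field_simp; ring
    rw [eq, abs_div, abs_of_pos he]
    apply div_le_div_of_nonneg_right _ he.le
    have := mul_nonneg e0.le c0
    have := mul_le_mul_of_nonneg_left c1 e0.le
    have := mul_nonneg ha.1 he.le
    have := mul_le_mul_of_nonneg_right ha.2 he.le
    rw [abs_le]; constructor <;> linarith
  -- martingale differences
  have hD0 : ∀ t, 1 ≤ t → ∀ Z : Ω → ℝ, Measurable[F (t-1)] Z → (∃ C, ∀ ω, |Z ω| ≤ C) →
      ∫ ω, Z ω * D t ω ∂μ = 0 := by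
    intro t ht Z hZ hZb
    have hYm := (hY_meas t ht).mono (F.le t) le_rfl
    have hSm := fun y => (hS_meas t ht y).mono (F.le t) le_rfl
    exact zero_mean (F (t-1)) _ μ le_sup_left
      (sup_le (F.le _) (Measurable.comap_le (hYm.prodMk (measurable_pi_lambda _ hSm))))
      K hK ε α hε (S t) (Y t) (U t) (Ybar t) hSm hYm
      ((hU_meas t ht).mono (F.le t) le_rfl) ((hYbar_meas t ht).mono (F.le t) le_rfl)
      (hU_unif t ht) (hYbar_unif t ht) (hIndep t ht)
      ((comap_measurable _).mono le_sup_right le_rfl) (Ytil t) (hYtil t ht) (τ t) (hτm' t ht)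
      Z hZ hZb
  -- concentration
  set x : ℝ := c * Real.sqrt (2 * Real.log (4 / δ)) * Real.sqrt T with hxdef
  have hx : 0 ≤ x := by positivity
  have hlog : 0 ≤ Real.log (4 / δ) := Real.log_nonneg (by rw [le_div_iff₀ d0]; linarith)
  have hexp : Real.exp (-(x^2 / (2 * c^2 * T))) = δ / 4 := by
    have : x^2 / (2 * c^2 * T) = Real.log (4 / δ) := by
      rw [hxdef, mul_pow, mul_pow, Real.sq_sqrt (by positivity), Real.sq_sqrt hT0.le]
      field_simp
    rw [this, Real.exp_neg, Real.exp_log (by positivity), inv_div]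
  have t1 := azuma_tail μ F D c hc hDm hDb hD0 T hT x hx
  have t2 := azuma_tail μ F (fun t ω => -D t ω) c hc (fun t ht => (hDm t ht).neg)
    (fun t ht ω => by rw [abs_neg]; exact hDb t ht ω)
    (fun t ht Z hZ hZb => by
      simp only [mul_neg]; rw [integral_neg, hD0 t ht Z hZ hZb, neg_zero]) T hT x hx
  rw [hexp] at t1 t2
  simp only [Finset.sum_neg_distrib] at t2
  set M : Ω → ℝ := fun ω => ∑ t ∈ Finset.Icc 1 T, D t ω with hM
  have hMm : Measurable M := Finset.measurable_sum _ fun t ht =>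
    (hDm t (Finset.mem_Icc.1 ht).1).mono (F.le t) le_rfl
  set E : Set Ω := {ω | x ≤ M ω} ∪ {ω | x ≤ -M ω} with hE
  have hEm : MeasurableSet E :=
    (measurableSet_le measurable_const hMm).union (measurableSet_le measurable_const hMm.neg)
  have hEp : μ.real E ≤ δ := by
    have := measureReal_union_le (μ := μ) {ω | x ≤ M ω} {ω | x ≤ -M ω}
    linarith
  have hEc : ENNReal.ofReal (1 - δ) ≤ μ Eᶜ := by
    rw [← ofReal_measureReal, probReal_compl_eq_one_sub hEm]
    exact ENNReal.ofReal_le_ofReal (by linarith)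
  refine hEc.trans (measure_mono fun ω hω => ?_)
  have hMx : |M ω| ≤ x := by
    simp only [hE, Set.mem_compl_iff, Set.mem_union, Set.mem_ofPred_eq, not_or, not_le] at hω
    rw [abs_le]; constructor <;> linarith [hω.1, hω.2]
  -- deterministic part
  have hHt : ∀ t ∈ Finset.Icc 1 T, η t ≤ H := fun t ht => le_max_eta η hη T t ht
  have hH0 : 0 ≤ H := (hη 1 le_rfl).le.trans (hHt 1 (by simp [hT]))
  have hbd : ∀ n, n ≤ T → -(H * ((α + ε * (1 - α)) / (1 - ε))) ≤ τ (n+1) ω ∧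
      τ (n+1) ω ≤ 1 + H * ((1 - α + ε * α) / (1 - ε)) := by
    intro n
    induction n with
    | zero =>
      intro _
      have hA : 0 ≤ H * ((α + ε * (1 - α)) / (1 - ε)) :=
        mul_nonneg hH0 (div_nonneg (by nlinarith [hα.1, hα.2]) he.le)
      have hB : 0 ≤ H * ((1 - α + ε * α) / (1 - ε)) :=
        mul_nonneg hH0 (div_nonneg (by nlinarith [hα.1, hα.2]) he.le)
      simp only [zero_add, hτ1]
      constructor <;> linarith [hτ0.1, hτ0.2]
    | succ n ih =>
      intro hn
      obtain ⟨i1, i2⟩ := ih (by omega)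
      rw [hupd (n+1) (by omega)]
      exact tau_bound α ε K hK hε hα _ H _ _ _ (fun y => hS_range (n+1) (by omega) y ω)
        (hS_range (n+1) (by omega) _ ω) (hη _ (by omega))
        (hHt _ (Finset.mem_Icc.2 ⟨by omega, hn⟩)) i1 i2
  have hR : |∑ t ∈ Finset.Icc 1 T, rg t ω| ≤
      (1 + H * ((1 + ε) / (1 - ε))) * ∑ t ∈ Finset.Icc 1 T, |(η t)⁻¹ - (η (t - 1))⁻¹| := by
    rw [abel_sum η (fun t => τ t ω) (fun t => rg t ω) hη hη0 (fun t ht => hupd t ht ω)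
      (τ (T+1) ω) T, sub_self, mul_zero, sub_zero, Finset.mul_sum]
    refine (Finset.abs_sum_le_sum_abs _ _).trans (Finset.sum_le_sum fun t ht => ?_)
    rw [abs_mul, mul_comm]
    refine mul_le_mul_of_nonneg_right ?_ (abs_nonneg _)
    obtain ⟨ht1, ht2⟩ := Finset.mem_Icc.1 ht
    have b1 := hbd (t-1) (by omega)
    rw [Nat.sub_add_cancel ht1] at b1
    have b2 := hbd T le_rfl
    have es : H * ((1 + ε) / (1 - ε)) = H * ((α + ε * (1 - α)) / (1 - ε))
        + H * ((1 - α + ε * α) / (1 - ε)) := by field_simp; ring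
    rw [es, abs_le]
    constructor <;> linarith [b1.1, b1.2, b2.1, b2.2]
  have hsum : (1 / (T : ℝ)) * (∑ t ∈ Finset.Icc 1 T,
      (if τ t ω < S t (Y t ω) ω then (1:ℝ) else 0)) - α
      = -(M ω + ∑ t ∈ Finset.Icc 1 T, rg t ω) / T := by
    have : M ω + ∑ t ∈ Finset.Icc 1 T, rg t ω = ∑ t ∈ Finset.Icc 1 T,
        (α - (if τ t ω < S t (Y t ω) ω then (1:ℝ) else 0)) := by
      simp only [hM]
      rw [← Finset.sum_add_distrib]
      refine Finset.sum_congr rfl fun t _ => ?_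
      simp only [hDdef]
      by_cases h : S t (Y t ω) ω ≤ τ t ω
      · simp [h, not_lt.mpr h]
      · simp [h, not_le.mp h]
    rw [this, Finset.sum_sub_distrib]
    simp only [Finset.sum_const, Nat.card_Icc, Nat.add_sub_cancel, nsmul_eq_mul]
    field_simp
    ring
  have hxT : c * Real.sqrt (2 * Real.log (4 / δ)) / Real.sqrt T = x / T := by
    rw [hxdef, div_eq_div_iff (Real.sqrt_pos.2 hT0).ne' hT0.ne', mul_assoc _ (Real.sqrt T),
      Real.mul_self_sqrt hT0.le]
  rw [Set.mem_ofPred_eq]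
  rw [hsum, hxT, ← add_div, abs_div, abs_neg, abs_of_pos hT0]
  apply div_le_div_of_nonneg_right _ hT0.le
  exact (abs_add_le _ _).trans (add_le_add hMx hR)
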